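/- Let w be a right maximal C∞-word of height k > 0. Then for every letter x ∈ Σ the word wx is a C∞-word, and for every 0 ≤ j < k one has |D^j(wx)| = |D^j(w)| + 1; moreover, if D^j(wx) = D^j(w)·y with y ∈ Σ, then D^j(w x̄) = D^j(w)·ȳ. Symmetrically, if w is a left maximal C∞-word of height k > 0, then for every x ∈ Σ, xw is a C∞-word, |D^j(xw)| = |D^j(w)| + 1 for all 0 ≤ j < k, and if D^j(xw) = y·D^j(w) with y ∈ Σ then D^j(x̄w) = ȳ·D^j(w). -/

import Mathlib

/- Common framework: words over the alphabet Σ = {1,2} (represented as natural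
numbers), run-length encoding, the derivative D, k-differentiable words C^k,
C∞-words, heights, roots, primitives, minimal/maximal words, simple extensions,
minimal forbidden words, and the left frontier Ψ. -/

namespace CinftyWords

/-- A word is a finite sequence of natural numbers. -/
abbrev Word := List ℕ

/-- `w` is a word over the alphabet Σ = {1,2}. -/
def IsWord (w : Word) : Prop := ∀ x ∈ w, x = 1 ∨ x = 2

/-- Complement of a letter: exchanges 1 and 2. -/
def bar (x : ℕ) : ℕ := 3 - x

/-- Letterwise complement of a word. -/
def comp (w : Word) : Word := w.map bar

/-- Run-length encoding Δ: the sequence of lengths of maximal runs of equal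
consecutive letters. -/
def rle (w : Word) : Word := (w.splitBy (· == ·)).map List.length

/-- Drop the first run if it has length 1. -/
def dropFirstRun1 (g : List (List ℕ)) : List (List ℕ) :=
  match g with
  | [] => []
  | r :: rs => if r.length = 1 then rs else r :: rs

/-- The derivative `D w`: the run-length encoding of the word obtained from `w`
by deleting its first and/or last run when that run has length 1. -/
def D (w : Word) : Word :=
  ((dropFirstRun1 ((dropFirstRun1 (w.splitBy (· == ·))).reverse)).reverse).map List.length

/-- `w` is differentiable: `w` is a word over Σ and so is its run-length encoding. -/
def Diffble (w : Word) : Prop := IsWord w ∧ IsWord (rle w)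

/-- The set C^k of k-differentiable words: `D^[j] w` is differentiable for all `j < k`
(so that `D^[k] w` is defined). -/
def CK (k : ℕ) : Set Word := {w | IsWord w ∧ ∀ j < k, Diffble (D^[j] w)}

/-- The set C∞ of words differentiable arbitrarily many times. -/
def Cinf : Set Word := {w | ∀ k : ℕ, w ∈ CK k}

/-- The height of a C∞-word: the least `k` with `D^[k] w = []`. -/
noncomputable def height (w : Word) : ℕ := sInf {k | D^[k] w = []}

/-- The root of a C∞-word: `D^[height w - 1] w`. -/
noncomputable def root (w : Word) : Word := D^[height w - 1] w

/-- `v` is a primitive of `w`: `v` is differentiable and `D v = w`. -/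
def IsPrimitive (v w : Word) : Prop := Diffble v ∧ D v = w

/-- A nonempty C∞-word is maximal if each `D^[j] w` (for `j ≤ height w - 2`) is a
primitive of `D^[j+1] w` of maximal length (vacuously true when `height w = 1`). -/
def MaximalWord (w : Word) : Prop :=
  w ∈ Cinf ∧ w ≠ [] ∧ ∀ j, j + 2 ≤ height w →
    ∀ v, IsPrimitive v (D^[j + 1] w) → v.length ≤ (D^[j] w).length

/-- A nonempty C∞-word is minimal if each `D^[j] w` (for `j ≤ height w - 2`) is a
primitive of `D^[j+1] w` of minimal length (vacuously true when `height w = 1`). -/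
def MinimalWord (w : Word) : Prop :=
  w ∈ Cinf ∧ w ≠ [] ∧ ∀ j, j + 2 ≤ height w →
    ∀ v, IsPrimitive v (D^[j + 1] w) → (D^[j] w).length ≤ v.length

/-- `w` is right maximal: a suffix of a maximal word. -/
def RightMaximal (w : Word) : Prop := ∃ v, MaximalWord v ∧ w <:+ v

/-- `w` is left maximal: a prefix of a maximal word. -/
def LeftMaximal (w : Word) : Prop := ∃ v, MaximalWord v ∧ w <+: v

/-- `w` is right minimal: a suffix of a minimal word. -/
def RightMinimal (w : Word) : Prop := ∃ v, MinimalWord v ∧ w <:+ v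

/-- `w` is left minimal: a prefix of a minimal word. -/
def LeftMinimal (w : Word) : Prop := ∃ v, MinimalWord v ∧ w <+: v

/-- `w` is right doubly extendable: both `w1` and `w2` are C∞-words. -/
def RightDoublyExt (w : Word) : Prop := w ++ [1] ∈ Cinf ∧ w ++ [2] ∈ Cinf

/-- `w` is left doubly extendable: both `1w` and `2w` are C∞-words. -/
def LeftDoublyExt (w : Word) : Prop := 1 :: w ∈ Cinf ∧ 2 :: w ∈ Cinf

/-- `w` is fully extendable: `1w1`, `1w2`, `2w1`, `2w2` are all C∞-words. -/
def FullyExt (w : Word) : Prop :=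
  ∀ x, (x = 1 ∨ x = 2) → ∀ y, (y = 1 ∨ y = 2) → x :: (w ++ [y]) ∈ Cinf

/-- `w'` is a right simple extension of `w`: `w' = w ++ s` is a C∞-word and at each
step the extension by the complementary letter is not a C∞-word. -/
def RightSimpleExt (w w' : Word) : Prop :=
  w' ∈ Cinf ∧ ∃ s : Word, IsWord s ∧ w' = w ++ s ∧
    ∀ i < s.length, w ++ s.take i ++ [bar (s.getD i 0)] ∉ Cinf

/-- `w'` is a left simple extension of `w`. -/
def LeftSimpleExt (w w' : Word) : Prop := RightSimpleExt w.reverse w'.reverse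

/-- `w'` is a simple extension of `w`: a right simple extension of a left simple
extension of `w`. -/
def SimpleExt (w w' : Word) : Prop := ∃ v, LeftSimpleExt w v ∧ RightSimpleExt v w'

/-- `m` is the maximal extension of `w`: a simple extension of `w` of maximal length. -/
def IsMaximalExtension (w m : Word) : Prop :=
  SimpleExt w m ∧ ∀ v, SimpleExt w v → v.length ≤ m.length

/-- A language is factorial if it is closed under taking factors. -/
def Factorial (F : Set Word) : Prop := ∀ v ∈ F, ∀ u, u <:+: v → u ∈ F

/-- A language is anti-factorial if no word of it is a proper factor of another
word of it. -/
def AntiFactorial (M : Set Word) : Prop := ∀ u ∈ M, ∀ v ∈ M, u ≠ v → ¬ u <:+: v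

/-- The set of minimal forbidden words of a (factorial) language `F`: words not
in `F` whose maximal proper prefix and maximal proper suffix are both in `F`. -/
def MF (F : Set Word) : Set Word := {v | v ∉ F ∧ v.dropLast ∈ F ∧ v.tail ∈ F}

/-- The height of a minimal forbidden word of C∞: `k + 1`, where `k` is the
(unique) integer such that `w` is k-differentiable and `D^[k] w ∈ {111, 222}`. -/
noncomputable def MFheight (w : Word) : ℕ :=
  sInf {k | w ∈ CK k ∧ (D^[k] w = [1, 1, 1] ∨ D^[k] w = [2, 2, 2])} + 1

/-- The left frontier Ψ of a C∞-word: the word of length `height w` over {0,1,2}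
recording the first letter of each derivative, with `2` replaced by `0` when the
first two letters of the previous derivative are distinct. -/
noncomputable def psi (w : Word) : List ℕ :=
  (List.range (height w)).map (fun i =>
    if i = 0 then w.getD 0 0
    else if (D^[i] w).getD 0 0 = 2 ∧ (D^[i - 1] w).getD 0 0 ≠ (D^[i - 1] w).getD 1 0 then 0
    else (D^[i] w).getD 0 0)

end CinftyWords

namespace CinftyWords

theorem rle_cons_of_ne {a b : ℕ} (h : a ≠ b) (u : Word) :
    rle (a :: b :: u) = 1 :: rle (b :: u) := by
  have h1 : (a :: b :: u).splitBy (· == ·) = [a].splitBy (· == ·) ++ (b :: u).splitBy (· == ·) :=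
    List.splitBy_append_cons (l := [a]) u (by simpa using h)
  have h2 : [a].splitBy (· == ·) = [[a]] := List.splitBy_of_isChain (by simp) (by simp)
  simp [rle, h1, h2]

theorem exists_rle_cons (a : ℕ) (u : Word) :
    ∃ n t, rle (a :: u) = (n + 1) :: t ∧ rle (a :: a :: u) = (n + 2) :: t := by
  rcases hs : (a :: u).splitBy (· == ·) with _ | ⟨g, gs⟩
  · simp at hs
  obtain ⟨h1, h2, h3, h4⟩ := List.splitBy_eq_iff.1 hs
  rcases g with _ | ⟨c, g⟩
  · simp at h2
  obtain rfl : a = c := by simp at h1; exact h1.1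
  have hs' : (a :: a :: u).splitBy (· == ·) = (a :: a :: g) :: gs := by
    rw [List.splitBy_eq_iff]
    refine ⟨by rw [h1]; simp, by simpa using h2, ?_, ?_⟩
    · intro m hm
      rcases List.mem_cons.1 hm with rfl | hm
      · have := h3 (a :: g) (by simp)
        simpa using this
      · exact h3 m (by simp [hm])
    · rw [List.isChain_cons] at h4 ⊢
      refine ⟨fun y hy => ?_, h4.2⟩
      obtain ⟨_, hb, h⟩ := h4.1 y hy
      exact ⟨by simp, hb, by simpa using h⟩
  exact ⟨g.length, gs.map List.length, by simp [rle, hs], by simp [rle, hs']⟩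

theorem rle_singleton (a : ℕ) : rle [a] = [1] := by
  have h2 : [a].splitBy (· == ·) = [[a]] := List.splitBy_of_isChain (by simp) (by simp)
  simp [rle, h2]

theorem rle_pair_self (a : ℕ) : rle [a, a] = [2] := by
  obtain ⟨n, t, h1, h2⟩ := exists_rle_cons a []
  rw [rle_singleton] at h1
  simp_all

theorem rle_reverse (w : Word) : rle w.reverse = (rle w).reverse := by
  obtain ⟨h1, h2, h3, h4⟩ := List.splitBy_eq_iff.1 (rfl : w.splitBy (· == ·) = _)
  have hs : w.reverse.splitBy (· == ·) = ((w.splitBy (· == ·)).map List.reverse).reverse := by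
    rw [List.splitBy_eq_iff]
    refine ⟨?_, by simp, ?_, ?_⟩
    · conv_lhs => rw [h1]
      rw [List.reverse_flatten]
    · intro m hm
      simp only [List.mem_reverse, List.mem_map] at hm
      obtain ⟨m', hm', rfl⟩ := hm
      rw [List.isChain_reverse]
      exact (h3 m' hm').imp fun a b h => BEq.comm.trans h
    · rw [List.isChain_reverse, List.isChain_map]
      refine h4.imp fun a b ⟨ha, hb, h⟩ => ⟨by simpa using hb, by simpa using ha, ?_⟩
      simp only [List.getLast_reverse, List.head_reverse]
      exact BEq.comm.trans h
  rw [rle, hs, rle]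
  simp [List.map_reverse, Function.comp_def]

/-- Delete the first letter when it is `1`. -/
def trimLeft : Word → Word
  | [] => []
  | n :: r => if n = 1 then r else n :: r

/-- Delete the last letter when it is `1`. -/
def trimRight (r : Word) : Word := (trimLeft r.reverse).reverse

theorem map_length_dropFirstRun1 (g : List (List ℕ)) :
    (dropFirstRun1 g).map List.length = trimLeft (g.map List.length) := by
  rcases g with _ | ⟨r, g⟩
  · rfl
  · simp only [dropFirstRun1, List.map_cons, trimLeft]
    split <;> simp

theorem D_eq_trim (w : Word) : D w = trimRight (trimLeft (rle w)) := by
  simp only [D, trimRight, rle, List.map_reverse, map_length_dropFirstRun1]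

theorem trimRight_cons_of_ne_nil (n : ℕ) {r : Word} (h : r ≠ []) :
    trimRight (n :: r) = n :: trimRight r := by
  cases r using List.reverseRecOn with
  | nil => exact absurd rfl h
  | append_singleton l a =>
    simp only [trimRight, List.reverse_cons, List.reverse_append, List.reverse_nil,
      List.nil_append, List.cons_append, trimLeft]
    split <;> simp

theorem trimRight_nil : trimRight [] = [] := rfl

theorem trimRight_one : trimRight [1] = [] := rfl

theorem trimRight_cons_of_ne_one {n : ℕ} (hn : n ≠ 1) (r : Word) :
    trimRight (n :: r) = n :: trimRight r := by
  rcases eq_or_ne r [] with rfl | h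
  · simp [trimRight, trimLeft, hn]
  · exact trimRight_cons_of_ne_nil n h

theorem trimRight_trimLeft_comm (r : Word) : trimRight (trimLeft r) = trimLeft (trimRight r) := by
  rcases r with _ | ⟨n, r⟩
  · rfl
  rcases eq_or_ne n 1 with rfl | hn
  · rcases eq_or_ne r [] with rfl | h
    · rfl
    · rw [trimRight_cons_of_ne_nil _ h]
      simp [trimLeft]
  · rw [trimRight_cons_of_ne_one hn]
    simp [trimLeft, hn, trimRight_cons_of_ne_one]

theorem D_reverse (w : Word) : D w.reverse = (D w).reverse := by
  rw [D_eq_trim, D_eq_trim, rle_reverse, trimRight_trimLeft_comm]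
  simp [trimRight]

theorem D_iterate_reverse (w : Word) (j : ℕ) : D^[j] w.reverse = (D^[j] w).reverse := by
  induction j with
  | zero => rfl
  | succ j ih => rw [Function.iterate_succ_apply', ih, D_reverse, Function.iterate_succ_apply']

theorem isWord_reverse {w : Word} : IsWord w.reverse ↔ IsWord w := by simp [IsWord]

theorem isWord_cons {a : ℕ} {w : Word} : IsWord (a :: w) ↔ (a = 1 ∨ a = 2) ∧ IsWord w := by
  simp [IsWord]

theorem diffble_reverse {w : Word} : Diffble w.reverse ↔ Diffble w := by
  rw [Diffble, rle_reverse, isWord_reverse, isWord_reverse, Diffble]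

theorem mem_Cinf_iff {w : Word} : w ∈ Cinf ↔ ∀ j, Diffble (D^[j] w) := by
  constructor
  · exact fun h j => (h (j + 1)).2 j j.lt_succ_self
  · exact fun h k => ⟨(h 0).1, fun j _ => h j⟩

theorem reverse_mem_Cinf {w : Word} : w.reverse ∈ Cinf ↔ w ∈ Cinf := by
  simp only [mem_Cinf_iff, D_iterate_reverse, diffble_reverse]

theorem height_reverse (w : Word) : height w.reverse = height w := by
  simp [height, D_iterate_reverse]

theorem IsPrimitive.reverse {v w : Word} (h : IsPrimitive v w) :
    IsPrimitive v.reverse w.reverse :=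
  ⟨diffble_reverse.2 h.1, by rw [D_reverse, h.2]⟩

theorem MaximalWord.reverse {v : Word} (h : MaximalWord v) : MaximalWord v.reverse := by
  obtain ⟨h1, h2, h3⟩ := h
  refine ⟨reverse_mem_Cinf.2 h1, by simpa using h2, fun j hj u hu => ?_⟩
  rw [height_reverse] at hj
  rw [D_iterate_reverse] at hu ⊢
  have := h3 j hj u.reverse (by simpa using hu.reverse)
  simpa using this

theorem RightMaximal.reverse {w : Word} (h : RightMaximal w) : LeftMaximal w.reverse := by
  obtain ⟨v, hv, hs⟩ := h
  exact ⟨v.reverse, hv.reverse, List.reverse_prefix.2 hs⟩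

theorem D_suffix_D_cons {a : ℕ} {w : Word} (h : Diffble (a :: w)) : D w <:+ D (a :: w) := by
  rcases w with _ | ⟨b, u⟩
  · rw [show D [] = [] from rfl]; exact List.nil_suffix
  rw [D_eq_trim, D_eq_trim]
  rcases eq_or_ne a b with rfl | hab
  · obtain ⟨n, t, h1, h2⟩ := exists_rle_cons a u
    have hn := h.2
    rw [h2, isWord_cons] at hn
    obtain rfl : n = 0 := by omega
    rw [h1, h2]
    simp [trimLeft, trimRight_cons_of_ne_one]
  · rw [rle_cons_of_ne hab]
    obtain ⟨n, t, h1, -⟩ := exists_rle_cons b u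
    rw [h1]
    rcases Nat.eq_zero_or_pos n with rfl | hn
    · simp only [trimLeft, Nat.zero_add, if_true]
      rcases eq_or_ne t [] with rfl | ht
      · simp [trimRight_nil, trimRight_one]
      · rw [trimRight_cons_of_ne_nil _ ht]
        exact List.suffix_cons _ _
    · simp [trimLeft, hn.ne']

theorem Diffble.of_cons {a : ℕ} {w : Word} (h : Diffble (a :: w)) : Diffble w := by
  refine ⟨(isWord_cons.1 h.1).2, ?_⟩
  rcases w with _ | ⟨b, u⟩
  · intro x hx
    simp [rle] at hx
  have hr := h.2
  rcases eq_or_ne a b with rfl | hab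
  · obtain ⟨n, t, h1, h2⟩ := exists_rle_cons a u
    rw [h2, isWord_cons] at hr
    rw [h1, isWord_cons]
    exact ⟨by omega, hr.2⟩
  · rw [rle_cons_of_ne hab, isWord_cons] at hr
    exact hr.2

theorem D_suffix_of_suffix {w v : Word} (hv : Diffble v) (h : w <:+ v) : D w <:+ D v := by
  obtain ⟨s, rfl⟩ := h
  induction s with
  | nil => exact List.suffix_rfl
  | cons a s ih => exact (ih hv.of_cons).trans (D_suffix_D_cons hv)

theorem D_prefix_of_prefix {w v : Word} (hv : Diffble v) (h : w <+: v) : D w <+: D v := by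
  rw [← List.reverse_suffix, ← D_reverse, ← D_reverse]
  exact D_suffix_of_suffix (diffble_reverse.2 hv) (List.reverse_suffix.2 h)

theorem D_iterate_prefix_of_prefix {w v : Word} (hv : v ∈ Cinf) (h : w <+: v) (j : ℕ) :
    D^[j] w <+: D^[j] v := by
  induction j with
  | zero => exact h
  | succ j ih =>
    rw [Function.iterate_succ_apply', Function.iterate_succ_apply']
    exact D_prefix_of_prefix (mem_Cinf_iff.1 hv j) ih

theorem length_trimLeft_le (r : Word) : (trimLeft r).length ≤ r.length := by
  rcases r with _ | ⟨n, r⟩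
  · rfl
  · simp only [trimLeft]
    split <;> simp

theorem length_trimRight_le (r : Word) : (trimRight r).length ≤ r.length := by
  simpa [trimRight] using length_trimLeft_le r.reverse

theorem length_rle_le (w : Word) : (rle w).length ≤ w.length := by
  induction w with
  | nil => simp [rle]
  | cons a u ih =>
    rcases u with _ | ⟨b, u⟩
    · simp [rle_singleton]
    rcases eq_or_ne a b with rfl | hab
    · obtain ⟨n, t, h1, h2⟩ := exists_rle_cons a u
      rw [h1] at ih
      rw [h2]
      simp at ih ⊢
      omega
    · rw [rle_cons_of_ne hab]
      simpa using ih

theorem length_D_cons_le (a : ℕ) (u : Word) : (D (a :: u)).length ≤ u.length := by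
  rw [D_eq_trim]
  refine (length_trimRight_le _).trans ?_
  rcases u with _ | ⟨b, u⟩
  · simp [rle_singleton, trimLeft]
  rcases eq_or_ne a b with rfl | hab
  · obtain ⟨n, t, h1, h2⟩ := exists_rle_cons a u
    have := length_rle_le (a :: u)
    rw [h1] at this
    rw [h2]
    exact (length_trimLeft_le _).trans (by simpa using this)
  · rw [rle_cons_of_ne hab]
    simpa [trimLeft] using length_rle_le (b :: u)

theorem D_iterate_nil (j : ℕ) : D^[j] [] = [] :=
  Function.iterate_fixed rfl j

theorem D_iterate_length (w : Word) : D^[w.length] w = [] := by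
  suffices ∀ n (w : Word), w.length ≤ n → D^[n] w = [] from this _ w le_rfl
  intro n
  induction n with
  | zero => intro w hw; simpa using hw
  | succ n ih =>
    intro w hw
    rw [Function.iterate_succ_apply]
    rcases w with _ | ⟨a, u⟩
    · exact ih _ (by simp [show D [] = [] from rfl])
    · exact ih _ ((length_D_cons_le a u).trans (by simpa using hw))

theorem D_iterate_height (w : Word) : D^[height w] w = [] :=
  Nat.sInf_mem (s := {k | D^[k] w = []}) ⟨_, D_iterate_length w⟩

theorem D_iterate_ne_nil_iff {w : Word} {j : ℕ} : D^[j] w ≠ [] ↔ j < height w := by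
  constructor
  · intro h
    by_contra! hj
    obtain ⟨i, rfl⟩ := Nat.exists_eq_add_of_le' hj
    rw [Function.iterate_add_apply, D_iterate_height] at h
    exact h (D_iterate_nil i)
  · exact fun h => Nat.notMem_of_lt_sInf h

theorem bar_mem {x : ℕ} (hx : x = 1 ∨ x = 2) : bar x = 1 ∨ bar x = 2 := by
  rcases hx with rfl | rfl <;> simp [bar]

theorem bar_ne {x : ℕ} (hx : x = 1 ∨ x = 2) : bar x ≠ x := by
  rcases hx with rfl | rfl <;> simp [bar]

theorem bar_bar {x : ℕ} (hx : x = 1 ∨ x = 2) : bar (bar x) = x := by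
  rcases hx with rfl | rfl <;> simp [bar]

/-- A word starting with a run of length two has a longer primitive of its derivative. -/
theorem isPrimitive_bar_cons {a : ℕ} {u : Word} (h : Diffble (a :: a :: u)) :
    IsPrimitive (bar a :: a :: a :: u) (D (a :: a :: u)) := by
  have ha := (isWord_cons.1 h.1).1
  have hr := rle_cons_of_ne (bar_ne ha) (a :: u)
  refine ⟨⟨isWord_cons.2 ⟨bar_mem ha, h.1⟩, ?_⟩, ?_⟩
  · rw [hr]
    exact isWord_cons.2 ⟨Or.inl rfl, h.2⟩
  · obtain ⟨n, t, -, h2⟩ := exists_rle_cons a u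
    rw [D_eq_trim, D_eq_trim, hr, h2]
    simp [trimLeft]

theorem D_singleton (a : ℕ) : D [a] = [] := by
  rw [D_eq_trim, rle_singleton]; rfl

theorem MaximalWord.starts_with_ne {v : Word} (hv : MaximalWord v) {j : ℕ}
    (hj : j + 2 ≤ height v) : ∃ a b u, a ≠ b ∧ D^[j] v = a :: b :: u := by
  have hne : D^[j + 1] v ≠ [] := D_iterate_ne_nil_iff.2 (by omega)
  have hmax := hv.2.2 j hj
  have hd := mem_Cinf_iff.1 hv.1 j
  rw [Function.iterate_succ_apply'] at hne hmax
  generalize D^[j] v = z at *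
  rcases z with _ | ⟨a, _ | ⟨b, u⟩⟩
  · exact absurd rfl hne
  · exact absurd (D_singleton a) hne
  · rcases eq_or_ne a b with rfl | hab
    · have := hmax _ (isPrimitive_bar_cons hd)
      simp at this
    · exact ⟨a, b, u, hab, rfl⟩

theorem LeftMaximal.starts_with_ne {w : Word} (hw : LeftMaximal w) {j : ℕ}
    (hj : j + 2 ≤ height w) : ∃ a b u, a ≠ b ∧ D^[j] w = a :: b :: u := by
  obtain ⟨v, hv, hp⟩ := hw
  have hne : D^[j + 1] w ≠ [] := D_iterate_ne_nil_iff.2 (by omega)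
  have hne' : D^[j + 1] v ≠ [] := fun h =>
    hne (List.prefix_nil.1 (h ▸ D_iterate_prefix_of_prefix hv.1 hp (j + 1)))
  obtain ⟨a, b, u, hab, hz⟩ := hv.starts_with_ne (D_iterate_ne_nil_iff.1 hne')
  have hpj := D_iterate_prefix_of_prefix hv.1 hp j
  rw [Function.iterate_succ_apply'] at hne
  rw [hz] at hpj
  generalize D^[j] w = z at *
  rcases z with _ | ⟨c, _ | ⟨d, t⟩⟩
  · exact absurd rfl hne
  · exact absurd (D_singleton c) hne
  · simp only [List.cons_prefix_cons] at hpj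
    obtain ⟨rfl, rfl, -⟩ := hpj
    exact ⟨c, d, t, hab, rfl⟩

theorem eq_of_D_eq_nil {w : Word} (hw : w ≠ []) (h : D w = []) :
    (∃ a, w = [a]) ∨ ∃ a b, a ≠ b ∧ w = [a, b] := by
  rcases w with _ | ⟨a, _ | ⟨b, u⟩⟩
  · exact absurd rfl hw
  · exact Or.inl ⟨a, rfl⟩
  rw [D_eq_trim] at h
  rcases eq_or_ne a b with rfl | hab
  · obtain ⟨n, t, -, h2⟩ := exists_rle_cons a u
    rw [h2] at h
    simp [trimLeft, trimRight_cons_of_ne_one] at h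
  · rw [rle_cons_of_ne hab] at h
    rcases u with _ | ⟨c, u⟩
    · exact Or.inr ⟨a, b, hab, rfl⟩
    simp only [trimLeft, if_true] at h
    rcases eq_or_ne b c with rfl | hbc
    · obtain ⟨n, t, -, h2⟩ := exists_rle_cons b u
      rw [h2] at h
      simp [trimRight_cons_of_ne_one] at h
    · obtain ⟨n, t, h1, -⟩ := exists_rle_cons c u
      rw [rle_cons_of_ne hbc, h1, trimRight_cons_of_ne_nil _ (by simp)] at h
      simp at h

theorem rle_cons_self_of_ne {a b : ℕ} (hab : a ≠ b) (u : Word) :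
    rle (a :: a :: b :: u) = 2 :: rle (b :: u) := by
  obtain ⟨n, t, h1, h2⟩ := exists_rle_cons a (b :: u)
  rw [rle_cons_of_ne hab] at h1
  simp only [List.cons.injEq] at h1
  obtain ⟨h0, rfl⟩ := h1
  rw [h2, show n = 0 by omega]

theorem D_cons_self_of_ne {a b : ℕ} (hab : a ≠ b) (u : Word) :
    D (a :: a :: b :: u) = 2 :: D (a :: b :: u) := by
  rw [D_eq_trim, D_eq_trim, rle_cons_self_of_ne hab, rle_cons_of_ne hab]
  simp [trimLeft, trimRight_cons_of_ne_one]

theorem D_cons_of_ne_of_ne {c a b : ℕ} (hca : c ≠ a) (hab : a ≠ b) (u : Word) :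
    D (c :: a :: b :: u) = 1 :: D (a :: b :: u) := by
  obtain ⟨n, t, h1, -⟩ := exists_rle_cons b u
  rw [D_eq_trim, D_eq_trim, rle_cons_of_ne hca, rle_cons_of_ne hab, h1]
  simp [trimLeft, trimRight_cons_of_ne_nil]

theorem eq_bar_of_ne {a y : ℕ} (ha : a = 1 ∨ a = 2) (hy : y = 1 ∨ y = 2) (h : y ≠ a) :
    y = bar a := by
  rcases ha with rfl | rfl <;> rcases hy with rfl | rfl <;> simp_all [bar]

theorem LeftMaximal.exists_D_iterate_cons {w : Word} (hw : w ∈ Cinf) (hl : LeftMaximal w)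
    {x : ℕ} (hx : x = 1 ∨ x = 2) {j : ℕ} (hj : j < height w) :
    ∃ y, (y = 1 ∨ y = 2) ∧ D^[j] (x :: w) = y :: D^[j] w ∧
      D^[j] (bar x :: w) = bar y :: D^[j] w := by
  induction j with
  | zero => exact ⟨x, hx, rfl, rfl⟩
  | succ j ih =>
    obtain ⟨y, hy, h1, h2⟩ := ih (by omega)
    obtain ⟨a, b, u, hab, hz⟩ := hl.starts_with_ne hj
    have ha : a = 1 ∨ a = 2 := (mem_Cinf_iff.1 hw j).1 a (by simp [hz])
    simp only [Function.iterate_succ_apply', h1, h2, hz]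
    rcases eq_or_ne y a with rfl | hya
    · exact ⟨2, Or.inr rfl, D_cons_self_of_ne hab u, D_cons_of_ne_of_ne (bar_ne hy) hab u⟩
    · rw [eq_bar_of_ne ha hy hya, bar_bar ha]
      exact ⟨1, Or.inl rfl, D_cons_of_ne_of_ne (bar_ne ha) hab u, D_cons_self_of_ne hab u⟩

theorem diffble_cons_of_ne {y a b : ℕ} {u : Word} (hy : y = 1 ∨ y = 2) (hab : a ≠ b)
    (h : Diffble (a :: b :: u)) : Diffble (y :: a :: b :: u) := by
  refine ⟨isWord_cons.2 ⟨hy, h.1⟩, ?_⟩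
  have hr := h.2
  rcases eq_or_ne y a with rfl | hya
  · rw [rle_cons_of_ne hab, isWord_cons] at hr
    rw [rle_cons_self_of_ne hab]
    exact isWord_cons.2 ⟨Or.inr rfl, hr.2⟩
  · rw [rle_cons_of_ne hya]
    exact isWord_cons.2 ⟨Or.inl rfl, hr⟩

theorem nil_mem_Cinf : ([] : Word) ∈ Cinf := by
  rw [mem_Cinf_iff]
  intro j
  rw [D_iterate_nil]
  constructor <;> intro x hx <;> simp [rle] at hx

theorem mem_Cinf_of_diffble {w : Word} (h : Diffble w) (hD : D w ∈ Cinf) : w ∈ Cinf := by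
  rw [mem_Cinf_iff] at *
  rintro (_ | j)
  · exact h
  · exact hD j

theorem singleton_mem_Cinf {a : ℕ} (ha : a = 1 ∨ a = 2) : [a] ∈ Cinf := by
  refine mem_Cinf_of_diffble ⟨?_, ?_⟩ (by rw [D_singleton]; exact nil_mem_Cinf)
  · simpa [IsWord] using ha
  · simp [rle_singleton, IsWord]

theorem cons_mem_Cinf_of_D_eq_nil {y : ℕ} {w : Word} (hy : y = 1 ∨ y = 2) (hd : Diffble w)
    (hw : w ≠ []) (h : D w = []) : y :: w ∈ Cinf := by
  rcases eq_of_D_eq_nil hw h with ⟨a, rfl⟩ | ⟨a, b, hab, rfl⟩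
  · rcases eq_or_ne y a with rfl | hya
    · have hD : D [y, y] = [2] := by rw [D_eq_trim, rle_pair_self]; rfl
      refine mem_Cinf_of_diffble ⟨isWord_cons.2 ⟨hy, hd.1⟩, ?_⟩ ?_
      · simp [rle_pair_self, IsWord]
      · rw [hD]; exact singleton_mem_Cinf (Or.inr rfl)
    · have hr : rle [y, a] = [1, 1] := by rw [rle_cons_of_ne hya, rle_singleton]
      refine mem_Cinf_of_diffble ⟨isWord_cons.2 ⟨hy, hd.1⟩, ?_⟩ ?_
      · simp [hr, IsWord]
      · rw [D_eq_trim, hr]; exact nil_mem_Cinf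
  · refine mem_Cinf_of_diffble (diffble_cons_of_ne hy hab hd) ?_
    rcases eq_or_ne y a with rfl | hya
    · rw [D_cons_self_of_ne hab, h]; exact singleton_mem_Cinf (Or.inr rfl)
    · rw [D_cons_of_ne_of_ne hya hab, h]; exact singleton_mem_Cinf (Or.inl rfl)

theorem LeftMaximal.cons_mem_Cinf {w : Word} (hw : w ∈ Cinf) (hl : LeftMaximal w)
    (hpos : 0 < height w) {x : ℕ} (hx : x = 1 ∨ x = 2) : x :: w ∈ Cinf := by
  obtain ⟨m, hm⟩ := Nat.exists_eq_add_one.2 hpos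
  have hd := mem_Cinf_iff.1 hw
  rw [mem_Cinf_iff]
  intro j
  rcases lt_or_ge j m with hj | hj
  · obtain ⟨y, hy, h1, -⟩ := hl.exists_D_iterate_cons hw hx (show j < height w by omega)
    obtain ⟨a, b, u, hab, hz⟩ := hl.starts_with_ne (show j + 2 ≤ height w by omega)
    rw [h1, hz]
    exact diffble_cons_of_ne hy hab (hz ▸ hd j)
  · obtain ⟨i, rfl⟩ := Nat.exists_eq_add_of_le' hj
    obtain ⟨y, hy, h1, -⟩ := hl.exists_D_iterate_cons hw hx (show m < height w by omega)
    have h0 := D_iterate_height w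
    rw [hm, Function.iterate_succ_apply'] at h0
    rw [Function.iterate_add_apply, h1]
    exact mem_Cinf_iff.1 (cons_mem_Cinf_of_D_eq_nil hy (hd m)
      (D_iterate_ne_nil_iff.2 (by omega)) h0) i

theorem LeftMaximal.extension {w : Word} (hw : w ∈ Cinf) (hl : LeftMaximal w)
    (hpos : 0 < height w) {x : ℕ} (hx : x = 1 ∨ x = 2) :
    x :: w ∈ Cinf ∧
      ∀ j < height w, (D^[j] (x :: w)).length = (D^[j] w).length + 1 ∧
        ∀ y, (y = 1 ∨ y = 2) → D^[j] (x :: w) = y :: D^[j] w →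
          D^[j] (bar x :: w) = bar y :: D^[j] w := by
  refine ⟨hl.cons_mem_Cinf hw hpos hx, fun j hj => ?_⟩
  obtain ⟨z, hz, h1, h2⟩ := hl.exists_D_iterate_cons hw hx hj
  refine ⟨by simp [h1], fun y _ h => ?_⟩
  rw [h1, List.cons.injEq] at h
  rw [h2, h.1]

end CinftyWords

open CinftyWords in
/-- If `w` is a right maximal C∞-word of height `k > 0`, then for every letter `x` the
word `wx` is a C∞-word, `|D^[j] (wx)| = |D^[j] w| + 1` for all `j < k`, and if
`D^[j] (wx) = D^[j] w · y` then `D^[j] (w x̄) = D^[j] w · ȳ`. Symmetrically for left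
maximal words and extensions on the left. -/
theorem derivative_length_of_extension_of_maximal (w : Word) (hw : w ∈ Cinf)
    (k : ℕ) (hk : height w = k) (hkpos : 0 < k) :
    (RightMaximal w →
      ∀ x, (x = 1 ∨ x = 2) →
        w ++ [x] ∈ Cinf ∧
        ∀ j < k, (D^[j] (w ++ [x])).length = (D^[j] w).length + 1 ∧
          ∀ y, (y = 1 ∨ y = 2) → D^[j] (w ++ [x]) = D^[j] w ++ [y] →
            D^[j] (w ++ [bar x]) = D^[j] w ++ [bar y]) ∧
    (LeftMaximal w →
      ∀ x, (x = 1 ∨ x = 2) →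
        x :: w ∈ Cinf ∧
        ∀ j < k, (D^[j] (x :: w)).length = (D^[j] w).length + 1 ∧
          ∀ y, (y = 1 ∨ y = 2) → D^[j] (x :: w) = y :: D^[j] w →
            D^[j] (bar x :: w) = bar y :: D^[j] w) := by
  subst hk
  refine ⟨fun hr x hx => ?_, fun hl x hx => hl.extension hw hkpos hx⟩
  obtain ⟨h1, h2⟩ := hr.reverse.extension (reverse_mem_Cinf.2 hw)
    (by rwa [height_reverse]) hx
  have key (c : ℕ) : c :: w.reverse = (w ++ [c]).reverse := by simp
  have key' (c : ℕ) (u : Word) : c :: u.reverse = (u ++ [c]).reverse := by simp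
  simp only [key, height_reverse, D_iterate_reverse, key', List.length_reverse,
    List.reverse_inj, reverse_mem_Cinf] at h1 h2
  exact ⟨h1, h2⟩
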